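/- arXiv:2205.10702 — 2 statements merged into one kernel-verified Lean document; each statement's English description precedes it below -/
import Mathlib

section
/- Let M ≥ 3 be an integer and let c, f_c, d, R_D be positive reals and θ_D a real with cos θ_D > 0. Set ξ_m = −(d²·f_c/(2R_D²))·(m−1)² for m = 1,…,M, and define X = (2π²/c²)·∑_{m=1}^{M}∑_{n=1}^{M} (2(ξ_m − ξ_n))², Y = (4π²·d·f_c·cos θ_D/c²)·∑_{m=1}^{M}∑_{n=1}^{M} 2(ξ_m − ξ_n)(m−n), Z = (8π²·f_c²·d²·cos²θ_D/c²)·∑_{m=1}^{M}∑_{n=1}^{M} (m−n)². Then XZ − Y² > 0 and the ellipse area satisfies π·M²/√(XZ − Y²) = 3√15·c²·R_D² / (2π·f_c²·d³·cos θ_D·(M²−1)·√(M²−4)). -/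
open Real Finset

/-- The effective offset sequence of a phased array (zero frequency offsets):
`ξ_m = −(d²·f_c/(2R_D²))·(m−1)²`. -/
noncomputable def xiPA (d f_c R_D : ℝ) (m : ℕ) : ℝ :=
  -(d ^ 2 * f_c / (2 * R_D ^ 2)) * ((m : ℝ) - 1) ^ 2

/-- Coefficient `X` of the half-power boundary quadratic form of Lemma 1. -/
noncomputable def coefX (c : ℝ) (M : ℕ) (ξ : ℕ → ℝ) : ℝ :=
  (2 * π ^ 2 / c ^ 2) * ∑ m ∈ Icc 1 M, ∑ n ∈ Icc 1 M, (2 * (ξ m - ξ n)) ^ 2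

/-- Coefficient `Y` of the half-power boundary quadratic form of Lemma 1. -/
noncomputable def coefY (c d f_c θ_D : ℝ) (M : ℕ) (ξ : ℕ → ℝ) : ℝ :=
  (4 * π ^ 2 * d * f_c * Real.cos θ_D / c ^ 2) *
    ∑ m ∈ Icc 1 M, ∑ n ∈ Icc 1 M, 2 * (ξ m - ξ n) * ((m : ℝ) - (n : ℝ))

/-- Coefficient `Z` of the half-power boundary quadratic form of Lemma 1. -/
noncomputable def coefZ (c d f_c θ_D : ℝ) (M : ℕ) : ℝ :=
  (8 * π ^ 2 * f_c ^ 2 * d ^ 2 * Real.cos θ_D ^ 2 / c ^ 2) *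
    ∑ m ∈ Icc 1 M, ∑ n ∈ Icc 1 M, ((m : ℝ) - (n : ℝ)) ^ 2

theorem sum_sum_sub_mul_sub {ι : Type*} (s : Finset ι) (p q : ι → ℝ) :
    ∑ m ∈ s, ∑ n ∈ s, (p m - p n) * (q m - q n) =
      2 * ((#s : ℝ) * ∑ m ∈ s, p m * q m - (∑ m ∈ s, p m) * ∑ m ∈ s, q m) := by
  have h (m n : ι) : (p m - p n) * (q m - q n) =
      p m * q m - p m * q n - p n * q m + p n * q n := by ring
  simp only [h, sum_add_distrib, sum_sub_distrib, sum_const, nsmul_eq_mul, ← mul_sum, ← sum_mul]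
  ring

theorem sum_Icc_sub_one (M : ℕ) :
    ∑ m ∈ Icc 1 M, ((m : ℝ) - 1) = (M : ℝ) * (M - 1) / 2 := by
  induction M with
  | zero => simp
  | succ k ih => rw [sum_Icc_succ_top (by lia), ih]; push_cast; ring

theorem sum_Icc_sub_one_sq (M : ℕ) :
    ∑ m ∈ Icc 1 M, ((m : ℝ) - 1) ^ 2 = (M : ℝ) * (M - 1) * (2 * M - 1) / 6 := by
  induction M with
  | zero => simp
  | succ k ih => rw [sum_Icc_succ_top (by lia), ih]; push_cast; ring

theorem sum_Icc_sub_one_cube (M : ℕ) :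
    ∑ m ∈ Icc 1 M, ((m : ℝ) - 1) ^ 3 = ((M : ℝ) * (M - 1) / 2) ^ 2 := by
  induction M with
  | zero => simp
  | succ k ih => rw [sum_Icc_succ_top (by lia), ih]; push_cast; ring

theorem sum_Icc_sub_one_pow_four (M : ℕ) :
    ∑ m ∈ Icc 1 M, ((m : ℝ) - 1) ^ 4 =
      (M : ℝ) * (M - 1) * (2 * M - 1) * (3 * M ^ 2 - 3 * M - 1) / 30 := by
  induction M with
  | zero => simp
  | succ k ih => rw [sum_Icc_succ_top (by lia), ih]; push_cast; ring

theorem sum_sum_sub_sq (M : ℕ) :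
    ∑ m ∈ Icc 1 M, ∑ n ∈ Icc 1 M, ((m : ℝ) - (n : ℝ)) ^ 2 =
      (M : ℝ) ^ 2 * (M ^ 2 - 1) / 6 := by
  have h := sum_sum_sub_mul_sub (Icc 1 M) (fun m => (m : ℝ) - 1) (fun m => (m : ℝ) - 1)
  simp only [sub_sub_sub_cancel_right, ← pow_two, sum_Icc_sub_one, sum_Icc_sub_one_sq,
    Nat.card_Icc, Nat.add_sub_cancel] at h
  rw [h]; ring

theorem sum_sum_sq_sub_sq_mul_sub (M : ℕ) :
    ∑ m ∈ Icc 1 M, ∑ n ∈ Icc 1 M,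
        (((m : ℝ) - 1) ^ 2 - ((n : ℝ) - 1) ^ 2) * ((m : ℝ) - (n : ℝ)) =
      (M : ℝ) ^ 2 * (M ^ 2 - 1) * (M - 1) / 6 := by
  have h := sum_sum_sub_mul_sub (Icc 1 M) (fun m => ((m : ℝ) - 1) ^ 2) (fun m => (m : ℝ) - 1)
  simp only [sub_sub_sub_cancel_right, ← pow_succ, Nat.reduceAdd, sum_Icc_sub_one,
    sum_Icc_sub_one_sq, sum_Icc_sub_one_cube, Nat.card_Icc, Nat.add_sub_cancel] at h
  rw [h]; ring

theorem sum_sum_sq_sub_sq_sq (M : ℕ) :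
    ∑ m ∈ Icc 1 M, ∑ n ∈ Icc 1 M, (((m : ℝ) - 1) ^ 2 - ((n : ℝ) - 1) ^ 2) ^ 2 =
      (M : ℝ) ^ 2 * (M ^ 2 - 1) * ((M - 1) ^ 2 / 6 + (M ^ 2 - 4) / 90) := by
  have h := sum_sum_sub_mul_sub (Icc 1 M) (fun m => ((m : ℝ) - 1) ^ 2)
    (fun m => ((m : ℝ) - 1) ^ 2)
  simp only [← pow_add, Nat.reduceAdd, sum_Icc_sub_one_sq,
    sum_Icc_sub_one_pow_four, Nat.card_Icc, Nat.add_sub_cancel] at h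
  simp only [pow_two (_ ^ 2 - _ ^ 2), h]
  ring

theorem coefX_xiPA (c d f_c R_D : ℝ) (M : ℕ) :
    coefX c M (xiPA d f_c R_D) = 8 * π ^ 2 / c ^ 2 * (d ^ 2 * f_c / (2 * R_D ^ 2)) ^ 2 *
      ((M : ℝ) ^ 2 * (M ^ 2 - 1) * ((M - 1) ^ 2 / 6 + (M ^ 2 - 4) / 90)) := by
  have h (m n : ℕ) : (2 * (xiPA d f_c R_D m - xiPA d f_c R_D n)) ^ 2 =
      4 * (d ^ 2 * f_c / (2 * R_D ^ 2)) ^ 2 * (((m : ℝ) - 1) ^ 2 - ((n : ℝ) - 1) ^ 2) ^ 2 := by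
    unfold xiPA; ring
  simp only [coefX, h, ← mul_sum, sum_sum_sq_sub_sq_sq]
  ring

theorem coefY_xiPA (c d f_c R_D θ_D : ℝ) (M : ℕ) :
    coefY c d f_c θ_D M (xiPA d f_c R_D) =
      -(8 * π ^ 2 * d * f_c * Real.cos θ_D / c ^ 2) * (d ^ 2 * f_c / (2 * R_D ^ 2)) *
        ((M : ℝ) ^ 2 * (M ^ 2 - 1) * (M - 1) / 6) := by
  have h (m n : ℕ) : 2 * (xiPA d f_c R_D m - xiPA d f_c R_D n) * ((m : ℝ) - (n : ℝ)) =
      -(2 * (d ^ 2 * f_c / (2 * R_D ^ 2))) *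
        ((((m : ℝ) - 1) ^ 2 - ((n : ℝ) - 1) ^ 2) * ((m : ℝ) - (n : ℝ))) := by
    unfold xiPA; ring
  simp only [coefY, h, ← mul_sum, sum_sum_sq_sub_sq_mul_sub]
  ring

theorem coefX_mul_coefZ_sub_coefY_sq_xiPA (c d f_c R_D θ_D : ℝ) (M : ℕ) :
    coefX c M (xiPA d f_c R_D) * coefZ c d f_c θ_D M -
        coefY c d f_c θ_D M (xiPA d f_c R_D) ^ 2 =
      (2 * π ^ 2 * f_c ^ 2 * d ^ 3 * Real.cos θ_D * M ^ 2 * (M ^ 2 - 1) /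
        (3 * c ^ 2 * R_D ^ 2)) ^ 2 * ((M ^ 2 - 4) / 15) := by
  rw [coefX_xiPA, coefY_xiPA, coefZ, sum_sum_sub_sq]
  ring

/-- Corollary 1 (ellipse area): for a phased array (`Δf_m = 0`,
`ξ_m = −(d²f_c/(2R_D²))(m−1)²`) with `M ≥ 3` antennas, `XZ − Y² > 0` and the
half-power ellipse area `πM²/√(XZ − Y²)` equals
`3√15·c²·R_D² / (2π·f_c²·d³·cos θ_D·(M²−1)·√(M²−4))`. -/
theorem phased_array_ellipse_area (M : ℕ) (hM : 3 ≤ M) (c f_c d R_D θ_D : ℝ)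
    (hc : 0 < c) (hf : 0 < f_c) (hd : 0 < d) (hR : 0 < R_D)
    (hθ : 0 < Real.cos θ_D) :
    0 < coefX c M (xiPA d f_c R_D) * coefZ c d f_c θ_D M -
        coefY c d f_c θ_D M (xiPA d f_c R_D) ^ 2 ∧
    π * (M : ℝ) ^ 2 / Real.sqrt (coefX c M (xiPA d f_c R_D) * coefZ c d f_c θ_D M -
        coefY c d f_c θ_D M (xiPA d f_c R_D) ^ 2) =
      3 * Real.sqrt 15 * c ^ 2 * R_D ^ 2 /
        (2 * π * f_c ^ 2 * d ^ 3 * Real.cos θ_D * ((M : ℝ) ^ 2 - 1) *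
          Real.sqrt ((M : ℝ) ^ 2 - 4)) := by
  have hM' : (3 : ℝ) ≤ M := by exact_mod_cast hM
  have h1 : 0 < (M : ℝ) ^ 2 - 1 := by nlinarith
  have h4 : 0 < (M : ℝ) ^ 2 - 4 := by nlinarith
  have hM0 : 0 < (M : ℝ) := by linarith
  rw [coefX_mul_coefZ_sub_coefY_sq_xiPA]
  refine ⟨by positivity, ?_⟩
  rw [Real.sqrt_mul (by positivity), Real.sqrt_sq (by positivity), Real.sqrt_div h4.le]
  field_simp
end

section
/- Let M ≥ 3 be an integer, let c, f_c, d, R_D be positive reals, θ_D a real with cos θ_D > 0, and α a real with α ≠ 1. Choose frequency offsets Δf_m = (f_c·d²/(2R_D²))·α·(m−1)², so that ξ_m = Δf_m − (d²f_c/(2R_D²))(m−1)² = (α−1)·(d²f_c/(2R_D²))·(m−1)² for m = 1,…,M, and define X = (2π²/c²)·∑_{m=1}^{M}∑_{n=1}^{M} (2(ξ_m − ξ_n))², Y = (4π²·d·f_c·cos θ_D/c²)·∑_{m=1}^{M}∑_{n=1}^{M} 2(ξ_m − ξ_n)(m−n), Z = (8π²·f_c²·d²·cos²θ_D/c²)·∑_{m=1}^{M}∑_{n=1}^{M}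 (m−n)². Let X_pa, Y_pa, Z_pa be the same quantities with Δf_m = 0 (i.e., ξ_m = −(d²f_c/(2R_D²))(m−1)²). Then XZ − Y² > 0, the range-dimension beamwidth satisfies 2√(M²Z/(XZ − Y²)) = (2/|1−α|)·√(M²·Z_pa/(X_pa·Z_pa − Y_pa²)), and the angular-dimension beamwidth satisfies 2√(M²X/(XZ − Y²)) = 2√(M²·X_pa/(X_pa·Z_pa − Y_pa²)). -/
open Real Finset

/-- Strict Cauchy-Schwarz inequality for finite sums of linearly independent families. -/
theorem sum_mul_sq_lt_of_mul_ne {ι : Type*} (s : Finset ι) (a v : ι → ℝ) {i j : ι}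
    (hi : i ∈ s) (hj : j ∈ s) (h : a i * v j ≠ a j * v i) :
    (∑ k ∈ s, a k * v k) ^ 2 < (∑ k ∈ s, a k ^ 2) * ∑ k ∈ s, v k ^ 2 := by
  set V := ∑ k ∈ s, v k ^ 2 with hV
  set W := ∑ k ∈ s, a k * v k with hW
  set A := ∑ k ∈ s, a k ^ 2 with hA
  have V_pos : 0 < V := by
    obtain ⟨k, hk, hvk⟩ : ∃ k ∈ s, v k ≠ 0 := by
      by_contra! hv
      exact h (by rw [hv i hi, hv j hj]; ring)
    exact sum_pos' (fun k _ => sq_nonneg (v k)) ⟨k, hk, by positivity⟩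
  have expand : ∑ k ∈ s, (V * a k - W * v k) ^ 2 = V * (A * V - W ^ 2) := by
    calc ∑ k ∈ s, (V * a k - W * v k) ^ 2
        = ∑ k ∈ s, (V ^ 2 * a k ^ 2 - 2 * V * W * (a k * v k) + W ^ 2 * v k ^ 2) :=
          sum_congr rfl fun k _ => by ring
      _ = V ^ 2 * A - 2 * V * W * W + W ^ 2 * V := by
          rw [sum_add_distrib, sum_sub_distrib, ← mul_sum, ← mul_sum, ← mul_sum]
      _ = V * (A * V - W ^ 2) := by ring
  have residual_pos : 0 < ∑ k ∈ s, (V * a k - W * v k) ^ 2 := by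
    obtain ⟨k, hk, hne⟩ : ∃ k ∈ s, V * a k - W * v k ≠ 0 := by
      by_contra! hv
      refine h (mul_left_cancel₀ V_pos.ne' ?_)
      linear_combination v j * hv i hi - v i * hv j hj
    exact sum_pos' (fun k _ => sq_nonneg _) ⟨k, hk, by positivity⟩
  rw [expand] at residual_pos
  linarith [pos_of_mul_pos_right residual_pos V_pos.le]

theorem coefX_const_mul (c : ℝ) (M : ℕ) (t : ℝ) (ξ : ℕ → ℝ) :
    coefX c M (fun m => t * ξ m) = t ^ 2 * coefX c M ξ := by
  simp only [coefX, mul_sum]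
  exact sum_congr rfl fun m _ => sum_congr rfl fun n _ => by ring

theorem coefY_const_mul (c d f_c θ_D : ℝ) (M : ℕ) (t : ℝ) (ξ : ℕ → ℝ) :
    coefY c d f_c θ_D M (fun m => t * ξ m) = t * coefY c d f_c θ_D M ξ := by
  simp only [coefY, mul_sum]
  exact sum_congr rfl fun m _ => sum_congr rfl fun n _ => by ring

/-- The half-power quadratic form is nondegenerate as soon as `ξ` is not affine on the first three
antennas. -/
theorem coefX_mul_coefZ_sub_coefY_sq_pos {M : ℕ} (hM : 3 ≤ M) {c f_c d θ_D : ℝ} (hc : c ≠ 0)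
    (hf : f_c ≠ 0) (hd : d ≠ 0) (hθ : Real.cos θ_D ≠ 0) {ξ : ℕ → ℝ}
    (hξ : ξ 3 - ξ 1 ≠ 2 * (ξ 2 - ξ 1)) :
    0 < coefX c M ξ * coefZ c d f_c θ_D M - coefY c d f_c θ_D M ξ ^ 2 := by
  have cauchy := sum_mul_sq_lt_of_mul_ne (Icc 1 M ×ˢ Icc 1 M)
    (fun p : ℕ × ℕ => 2 * (ξ p.1 - ξ p.2)) (fun p => (p.1 : ℝ) - (p.2 : ℝ))
    (i := (3, 1)) (j := (2, 1))
    (by simp only [mem_product, mem_Icc]; omega) (by simp only [mem_product, mem_Icc]; omega)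
    (fun h => hξ (by norm_num at h; linarith))
  simp only [sum_product] at cauchy
  have factor_pos : 0 < 16 * π ^ 4 * f_c ^ 2 * d ^ 2 * Real.cos θ_D ^ 2 / c ^ 4 := by positivity
  refine (mul_pos factor_pos (sub_pos.2 cauchy)).trans_eq ?_
  simp only [coefX, coefY, coefZ]
  ring

/-- Proposition 1: with frequency offsets `Δf_m = (f_c d²/(2R_D²))·α·(m−1)²`
(so `ξ_m = (α−1)·(d²f_c/(2R_D²))·(m−1)²`), for `M ≥ 3` and `α ≠ 1` the half-power
boundary is an ellipse (`XZ − Y² > 0`), the range-dimension beamwidth equals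
`(2/|1−α|)·√(M²Z_pa/(X_pa Z_pa − Y_pa²))`, and the angular-dimension beamwidth
equals the phased-array value `2√(M²X_pa/(X_pa Z_pa − Y_pa²))`. -/
theorem proposition1_beamwidths (M : ℕ) (hM : 3 ≤ M) (c f_c d R_D θ_D α : ℝ)
    (hc : 0 < c) (hf : 0 < f_c) (hd : 0 < d) (hR : 0 < R_D)
    (hθ : 0 < Real.cos θ_D) (hα : α ≠ 1) :
    let ξ : ℕ → ℝ := fun m => (α - 1) * (d ^ 2 * f_c / (2 * R_D ^ 2)) * ((m : ℝ) - 1) ^ 2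
    let ξpa : ℕ → ℝ := fun m => -(d ^ 2 * f_c / (2 * R_D ^ 2)) * ((m : ℝ) - 1) ^ 2
    let X := coefX c M ξ
    let Y := coefY c d f_c θ_D M ξ
    let Z := coefZ c d f_c θ_D M
    let Xpa := coefX c M ξpa
    let Ypa := coefY c d f_c θ_D M ξpa
    let Zpa := coefZ c d f_c θ_D M
    0 < X * Z - Y ^ 2 ∧
    2 * Real.sqrt ((M : ℝ) ^ 2 * Z / (X * Z - Y ^ 2)) =
      (2 / |1 - α|) * Real.sqrt ((M : ℝ) ^ 2 * Zpa / (Xpa * Zpa - Ypa ^ 2)) ∧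
    2 * Real.sqrt ((M : ℝ) ^ 2 * X / (X * Z - Y ^ 2)) =
      2 * Real.sqrt ((M : ℝ) ^ 2 * Xpa / (Xpa * Zpa - Ypa ^ 2)) := by
  intro ξ ξpa X Y Z Xpa Ypa Zpa
  have scale_ne : 1 - α ≠ 0 := sub_ne_zero.2 hα.symm
  have hξ : ξ = fun m => (1 - α) * ξpa m := by
    funext m
    simp only [ξ, ξpa]
    ring
  have hX : X = (1 - α) ^ 2 * Xpa := by simp only [X, Xpa, hξ, coefX_const_mul]
  have hY : Y = (1 - α) * Ypa := by simp only [Y, Ypa, hξ, coefY_const_mul]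
  have hZ : Z = Zpa := rfl
  have disc_pa_pos : 0 < Xpa * Zpa - Ypa ^ 2 := by
    refine coefX_mul_coefZ_sub_coefY_sq_pos hM hc.ne' hf.ne' hd.ne' hθ.ne' fun h => ?_
    have curvature_pos : 0 < d ^ 2 * f_c / (2 * R_D ^ 2) := by positivity
    simp only [ξpa] at h
    norm_num at h
    linarith
  have hdisc : X * Z - Y ^ 2 = (1 - α) ^ 2 * (Xpa * Zpa - Ypa ^ 2) := by
    rw [hX, hY, hZ]
    ring
  rw [hdisc]
  refine ⟨by positivity, ?_, ?_⟩
  · have hquot : (M : ℝ) ^ 2 * Z / ((1 - α) ^ 2 * (Xpa * Zpa - Ypa ^ 2)) =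
        (1 / |1 - α|) ^ 2 * ((M : ℝ) ^ 2 * Zpa / (Xpa * Zpa - Ypa ^ 2)) := by
      rw [hZ, div_pow, sq_abs, one_pow, div_mul_div_comm, one_mul]
    rw [hquot, Real.sqrt_mul (sq_nonneg _), Real.sqrt_sq (by positivity)]
    ring
  · rw [hX, mul_left_comm, mul_div_mul_left _ _ (pow_ne_zero 2 scale_ne)]
end
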